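/- arXiv:2207.01999 — 2 statements merged into one kernel-verified Lean document; each statement's English description precedes it below -/
import Mathlib

section
/- (Universality of the monotone C*-algebra.) Let A be a unital C*-algebra and let (c_i)_{i∈ℤ} be a family of elements of A satisfying the monotone rules: (i) c_i c_j = 0 whenever i ≤ j; (ii) c_i c_j (c_j)* = c_i if i > j and c_i c_j (c_j)* = 0 if i ≤ j; (iii) (c_i)* c_i = c_{i−1}(c_{i−1})* − c_i(c_i)* for every i; (iv) c_i (c_i)* c_j = c_j − Σ_{k=j+1}^{i} (c_k)* c_k c_j if i > j, and c_i (c_i)* c_j = c_j if i ≤ j. Then there exists a unique continuous unital star-algebra homomorphism Φ : 𝔐 → A such that Φ(a_i) = c_i for every i ∈ ℤ. -/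
noncomputable section

open ContinuousLinearMap
open scoped InnerProductSpace ComplexOrder

/-- The discrete monotone Fock space: `ℓ²` over the finite subsets of `ℤ`. -/
abbrev MF : Type := lp (fun _ : Finset ℤ => ℂ) 2

/-- The canonical orthonormal basis vector corresponding to a finite subset `S ⊆ ℤ`;
`eS ∅` is the vacuum vector `Ω`. -/
noncomputable def eS (S : Finset ℤ) : MF := lp.single 2 S 1

/-- `a : ℤ → MF →L[ℂ] MF` is the family of monotone annihilation operators:
`a i (eS S) = eS (S \ {i})` if `S` is nonempty with `min S = i`, and `a i (eS S) = 0`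
otherwise.  The creation operator `a_i†` is the Hilbert-space adjoint of `a i`. -/
def IsMonotoneAnnihilation (a : ℤ → MF →L[ℂ] MF) : Prop :=
  ∀ (i : ℤ) (S : Finset ℤ),
    (S.min = (i : WithBot ℤ) → a i (eS S) = eS (S.erase i)) ∧
    (S.min ≠ (i : WithBot ℤ) → a i (eS S) = 0)

/-- The monotone C*-algebra `𝔐`: the unital C*-subalgebra of `B(F)` generated by the
annihilation operators. -/
noncomputable def MonM (a : ℤ → MF →L[ℂ] MF) : StarSubalgebra ℂ (MF →L[ℂ] MF) :=
  (StarAlgebra.adjoin ℂ (Set.range a)).topologicalClosure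

lemma a_mem_MonM (a : ℤ → MF →L[ℂ] MF) (i : ℤ) : a i ∈ MonM a :=
  StarSubalgebra.le_topologicalClosure _ (StarAlgebra.subset_adjoin ℂ _ ⟨i, rfl⟩)

lemma aad_mem_MonM (a : ℤ → MF →L[ℂ] MF) (i : ℤ) :
    (a i).comp (adjoint (a i)) ∈ MonM a := by
  have h := mul_mem (a_mem_MonM a i) (star_mem (a_mem_MonM a i))
  rwa [star_eq_adjoint, mul_def] at h

lemma ada_mem_MonM (a : ℤ → MF →L[ℂ] MF) (i : ℤ) :
    (adjoint (a i)).comp (a i) ∈ MonM a := by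
  have h := mul_mem (star_mem (a_mem_MonM a i)) (a_mem_MonM a i)
  rwa [star_eq_adjoint, mul_def] at h

/-- The part of the monotone rules that determines the C*-algebra they generate. -/
structure MonotoneRules {R : Type*} [CStarAlgebra R] (d : ℤ → R) : Prop where
  mul_eq_zero : ∀ {i j : ℤ}, i ≤ j → d i * d j = 0
  range_mul_star : ∀ {i j : ℤ}, j < i → d j * star (d j) * star (d i) = star (d i)
  range_mul : ∀ {i j : ℤ}, i ≤ j → d i * star (d i) * d j = d j
  source_add_range : ∀ i : ℤ,
    star (d i) * d i + d i * star (d i) = d (i - 1) * star (d (i - 1))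

/-- The words in `star (d (n - k + 1)), …, star (d n)` with increasing indices, applied to the
projection `d n * star (d n)`. -/
def creationWords {R : Type*} [CStarAlgebra R] (d : ℤ → R) (n : ℤ) : ℕ → Set R
  | 0 => {d n * star (d n)}
  | k + 1 => creationWords d n k ∪ (fun w => star (d (n - k)) * w) '' creationWords d n k

/-- The span of the matrix units `u * star v` for creation words `u` and `v`. -/
def matrixUnitSpan {R : Type*} [CStarAlgebra R] (d : ℤ → R) (n : ℤ) (k : ℕ) : Submodule ℂ R :=
  Submodule.span ℂ (Set.image2 (fun u v => u * star v) (creationWords d n k)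
    (creationWords d n k))

section CreationWords

variable {R : Type*} [CStarAlgebra R] {d : ℤ → R} {n : ℤ} {k : ℕ} {u v x y : R}

lemma finite_creationWords (d : ℤ → R) (n : ℤ) (k : ℕ) : (creationWords d n k).Finite := by
  induction k with
  | zero => exact Set.finite_singleton _
  | succ k ih => exact ih.union (ih.image _)

lemma creationWords_mono (d : ℤ → R) (n : ℤ) : Monotone (creationWords d n) :=
  monotone_nat_of_le_succ fun _ => Set.subset_union_left

lemma matrixUnitSpan_mono (d : ℤ → R) (n : ℤ) : Monotone (matrixUnitSpan d n) := fun _ _ h =>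
  Submodule.span_mono (Set.image2_subset (creationWords_mono d n h) (creationWords_mono d n h))

lemma mul_star_mem_matrixUnitSpan (hu : u ∈ creationWords d n k) (hv : v ∈ creationWords d n k) :
    u * star v ∈ matrixUnitSpan d n k :=
  Submodule.subset_span (Set.mem_image2_of_mem hu hv)

instance finiteDimensional_matrixUnitSpan (d : ℤ → R) (n : ℤ) (k : ℕ) :
    FiniteDimensional ℂ (matrixUnitSpan d n k) :=
  FiniteDimensional.span_of_finite ℂ
    ((finite_creationWords d n k).image2 _ (finite_creationWords d n k))

lemma star_mem_matrixUnitSpan (hx : x ∈ matrixUnitSpan d n k) :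
    star x ∈ matrixUnitSpan d n k := by
  induction hx using Submodule.span_induction with
  | mem x hx =>
    obtain ⟨u, hu, v, hv, rfl⟩ := hx
    simpa using mul_star_mem_matrixUnitSpan hv hu
  | zero => simp
  | add x y _ _ hx hy => simpa using add_mem hx hy
  | smul c x _ hx => simpa using Submodule.smul_mem _ _ hx

lemma star_mul_mul_mem_matrixUnitSpan (hx : x ∈ matrixUnitSpan d n k) :
    star (d (n - k)) * x * d (n - k) ∈ matrixUnitSpan d n (k + 1) := by
  induction hx using Submodule.span_induction with
  | mem x hx =>
    obtain ⟨u, hu, v, hv, rfl⟩ := hx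
    have h := mul_star_mem_matrixUnitSpan (d := d) (n := n) (k := k + 1)
      (.inr ⟨u, hu, rfl⟩) (.inr ⟨v, hv, rfl⟩)
    simpa [mul_assoc] using h
  | zero => simp
  | add x y _ _ hx hy => simpa only [mul_add, add_mul] using add_mem hx hy
  | smul c x _ hx =>
    simpa only [mul_smul_comm, smul_mul_assoc] using Submodule.smul_mem _ _ hx

lemma exists_mem_adjoin_image_Ioc (hx : x ∈ StarAlgebra.adjoin ℂ (Set.range d)) :
    ∃ N : ℕ, x ∈ StarAlgebra.adjoin ℂ (d '' Set.Ioc ((N : ℤ) - (2 * N : ℕ)) N) := by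
  have mono : Monotone fun N : ℕ =>
      StarAlgebra.adjoin ℂ (d '' Set.Ioc ((N : ℤ) - (2 * N : ℕ)) N) := fun M N h =>
    StarAlgebra.adjoin_mono (Set.image_mono (Set.Ioc_subset_Ioc (by lia) (by lia)))
  induction hx using StarAlgebra.adjoin_induction with
  | mem x hx =>
    obtain ⟨i, rfl⟩ := hx
    exact ⟨i.natAbs + 1, StarAlgebra.subset_adjoin _ _ ⟨i, ⟨by lia, by lia⟩, rfl⟩⟩
  | algebraMap r => exact ⟨0, algebraMap_mem _ r⟩
  | add x y _ _ hx hy =>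
    obtain ⟨M, hM⟩ := hx
    obtain ⟨N, hN⟩ := hy
    exact ⟨max M N, add_mem (mono (le_max_left M N) hM) (mono (le_max_right M N) hN)⟩
  | mul x y _ _ hx hy =>
    obtain ⟨M, hM⟩ := hx
    obtain ⟨N, hN⟩ := hy
    exact ⟨max M N, mul_mem (mono (le_max_left M N) hM) (mono (le_max_right M N) hN)⟩
  | star x _ hx =>
    obtain ⟨N, hN⟩ := hx
    exact ⟨N, star_mem hN⟩

namespace MonotoneRules

variable (hd : MonotoneRules d)
include hd

lemma range_mul_creationWord {i : ℤ} (hi : i ≤ n - k) (hu : u ∈ creationWords d n k) :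
    d i * star (d i) * u = u := by
  induction k generalizing u with
  | zero =>
    obtain rfl : u = _ := hu
    rw [← mul_assoc, hd.range_mul (by simpa using hi)]
  | succ k ih =>
    push_cast at hi
    obtain hu | ⟨w, -, rfl⟩ := hu
    · exact ih (by lia) hu
    · dsimp only
      rw [← mul_assoc, hd.range_mul_star (by lia)]

lemma mul_creationWord_eq_zero {i : ℤ} (hi : i ≤ n - k) (hu : u ∈ creationWords d n k) :
    d i * u = 0 := by
  rw [← hd.range_mul_creationWord hi hu, ← mul_assoc, ← mul_assoc, hd.mul_eq_zero le_rfl,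
    zero_mul, zero_mul]

lemma star_mul_creationWord {i : ℤ} (hi : n - k < i) (hin : i ≤ n)
    (hu : u ∈ creationWords d n k) :
    star (d i) * u ∈ creationWords d n k ∨ star (d i) * u = 0 := by
  induction k generalizing u with
  | zero => simp at hi; lia
  | succ k ih =>
    push_cast at hi
    rcases (show n - k ≤ i by lia).eq_or_lt with rfl | h
    · obtain hu | ⟨w, -, rfl⟩ := hu
      · exact .inl (.inr ⟨u, hu, rfl⟩)
      · right
        dsimp only
        rw [← mul_assoc, ← star_mul, hd.mul_eq_zero le_rfl, star_zero, zero_mul]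
    · obtain hu | ⟨w, -, rfl⟩ := hu
      · exact (ih h hu).imp_left .inl
      · right
        dsimp only
        rw [← mul_assoc, ← star_mul, hd.mul_eq_zero h.le, star_zero, zero_mul]

lemma creationWord_mul_range (hu : u ∈ creationWords d n k) : u * (d n * star (d n)) = u := by
  induction k generalizing u with
  | zero =>
    obtain rfl : u = _ := hu
    rw [← mul_assoc, hd.range_mul le_rfl]
  | succ k ih =>
    obtain hu | ⟨w, hw, rfl⟩ := hu
    · exact ih hu
    · dsimp only
      rw [mul_assoc, ih hw]

lemma star_mul_creationWords (hu : u ∈ creationWords d n k) (hv : v ∈ creationWords d n k) :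
    ∃ c : ℂ, star u * v = c • (d n * star (d n)) := by
  induction k generalizing u v with
  | zero =>
    obtain rfl : u = _ := hu
    obtain rfl : v = _ := hv
    refine ⟨1, ?_⟩
    rw [star_mul, star_star, ← mul_assoc, hd.range_mul le_rfl, one_smul]
  | succ k ih =>
    obtain hu | ⟨u, hu, rfl⟩ := hu <;> obtain hv | ⟨v, hv, rfl⟩ := hv
    · exact ih hu hv
    · refine ⟨0, ?_⟩
      have h := congrArg star (hd.mul_creationWord_eq_zero le_rfl hu)
      rw [star_mul, star_zero] at h
      rw [← mul_assoc, h, zero_mul, zero_smul]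
    · refine ⟨0, ?_⟩
      dsimp only
      rw [star_mul, star_star, mul_assoc, hd.mul_creationWord_eq_zero le_rfl hv, mul_zero,
        zero_smul]
    · dsimp only
      rw [star_mul, star_star, mul_assoc, ← mul_assoc (d _), hd.range_mul_creationWord le_rfl hv]
      exact ih hu hv

lemma mul_mem_matrixUnitSpan (hx : x ∈ matrixUnitSpan d n k) (hy : y ∈ matrixUnitSpan d n k) :
    x * y ∈ matrixUnitSpan d n k := by
  induction hx, hy using Submodule.span_induction₂ with
  | mem_mem x y hx hy =>
    obtain ⟨u, hu, v, hv, rfl⟩ := hx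
    obtain ⟨u', hu', v', hv', rfl⟩ := hy
    obtain ⟨c, hc⟩ := hd.star_mul_creationWords hv hu'
    have h : u * star v * (u' * star v') = c • (u * star v') := by
      rw [mul_assoc, ← mul_assoc (star v), hc, smul_mul_assoc, mul_smul_comm, ← mul_assoc,
        hd.creationWord_mul_range hu]
    simpa only [h] using Submodule.smul_mem _ _ (mul_star_mem_matrixUnitSpan hu hv')
  | zero_left y _ => simp
  | zero_right x _ => simp
  | add_left x y z _ _ _ hx hy => simpa only [add_mul] using add_mem hx hy
  | add_right x y z _ _ _ hx hy => simpa only [mul_add] using add_mem hx hy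
  | smul_left c x y _ _ h => simpa only [smul_mul_assoc] using Submodule.smul_mem _ _ h
  | smul_right c x y _ _ h => simpa only [mul_smul_comm] using Submodule.smul_mem _ _ h

lemma range_mem_matrixUnitSpan (n : ℤ) (k : ℕ) :
    d (n - k) * star (d (n - k)) ∈ matrixUnitSpan d n k := by
  induction k with
  | zero =>
    have h := mul_star_mem_matrixUnitSpan (d := d) (n := n) (k := 0) rfl rfl
    rw [star_mul, star_star, ← mul_assoc, hd.range_mul le_rfl] at h
    simpa using h
  | succ k ih =>
    have h := star_mul_mul_mem_matrixUnitSpan ih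
    rw [mul_assoc, hd.range_mul le_rfl] at h
    rw [Nat.cast_succ, ← sub_sub, ← hd.source_add_range]
    exact add_mem h (matrixUnitSpan_mono d n k.le_succ ih)

lemma mul_mem_matrixUnitSpan_of_lt {i : ℤ} (hi : n - k < i) (hin : i ≤ n)
    (hx : x ∈ matrixUnitSpan d n k) : x * d i ∈ matrixUnitSpan d n k := by
  induction hx using Submodule.span_induction with
  | mem x hx =>
    obtain ⟨u, hu, v, hv, rfl⟩ := hx
    have h : u * star v * d i = u * star (star (d i) * v) := by simp [mul_assoc]
    dsimp only
    rw [h]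
    obtain h | h := hd.star_mul_creationWord hi hin hv
    · exact mul_star_mem_matrixUnitSpan hu h
    · simp [h]
  | zero => simp
  | add x y _ _ hx hy => simpa only [add_mul] using add_mem hx hy
  | smul c x _ hx => simpa only [smul_mul_assoc] using Submodule.smul_mem _ _ hx

lemma mem_matrixUnitSpan {i : ℤ} (hi : n - k < i) (hin : i ≤ n) : d i ∈ matrixUnitSpan d n k := by
  have h := hd.range_mem_matrixUnitSpan n (n - i).toNat
  rw [show n - ((n - i).toNat : ℤ) = i by lia] at h
  rw [← hd.range_mul (le_refl i)]
  exact hd.mul_mem_matrixUnitSpan_of_lt hi hin (matrixUnitSpan_mono d n (by lia) h)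

/-- The unital star subalgebra spanned by `1` and the matrix units. -/
def matrixUnitAlgebra (n : ℤ) (k : ℕ) : StarSubalgebra ℂ R where
  carrier := (Submodule.span ℂ {1} ⊔ matrixUnitSpan d n k : Submodule ℂ R)
  mul_mem' {x y} hx hy := by
    obtain ⟨_, hs, s, hs', rfl⟩ := Submodule.mem_sup.1 hx
    obtain ⟨_, ht, t, ht', rfl⟩ := Submodule.mem_sup.1 hy
    obtain ⟨a, rfl⟩ := Submodule.mem_span_singleton.1 hs
    obtain ⟨b, rfl⟩ := Submodule.mem_span_singleton.1 ht
    refine Submodule.mem_sup.2 ⟨(a * b) • 1,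
      Submodule.smul_mem _ _ (Submodule.mem_span_singleton_self _), a • t + b • s + s * t,
      add_mem (add_mem (Submodule.smul_mem _ _ ht') (Submodule.smul_mem _ _ hs'))
        (hd.mul_mem_matrixUnitSpan hs' ht'), ?_⟩
    simp only [mul_add, add_mul, smul_mul_assoc, mul_smul_comm, one_mul, mul_one, smul_add,
      smul_smul, mul_comm b a]
    abel
  add_mem' hx hy := add_mem hx hy
  algebraMap_mem' r := by
    rw [Algebra.algebraMap_eq_smul_one]
    exact Submodule.mem_sup_left (Submodule.smul_mem _ _ (Submodule.mem_span_singleton_self _))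
  star_mem' {x} hx := by
    obtain ⟨_, hs, s, hs', rfl⟩ := Submodule.mem_sup.1 hx
    obtain ⟨a, rfl⟩ := Submodule.mem_span_singleton.1 hs
    refine Submodule.mem_sup.2 ⟨star a • 1, Submodule.smul_mem _ _
      (Submodule.mem_span_singleton_self _), star s, star_mem_matrixUnitSpan hs', by simp⟩

lemma mem_matrixUnitAlgebra : x ∈ hd.matrixUnitAlgebra n k ↔
    ∃ c : ℂ, ∃ t ∈ matrixUnitSpan d n k, c • 1 + t = x := by
  change x ∈ (Submodule.span ℂ {1} ⊔ matrixUnitSpan d n k : Submodule ℂ R) ↔ _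
  simp [Submodule.mem_sup, Submodule.mem_span_singleton]

lemma isClosed_matrixUnitAlgebra (n : ℤ) (k : ℕ) :
    IsClosed (hd.matrixUnitAlgebra n k : Set R) :=
  Submodule.closed_of_finiteDimensional
    (Submodule.span ℂ {1} ⊔ matrixUnitSpan d n k : Submodule ℂ R)

lemma adjoin_le_matrixUnitAlgebra (n : ℤ) (k : ℕ) :
    StarAlgebra.adjoin ℂ (d '' Set.Ioc (n - k) n) ≤ hd.matrixUnitAlgebra n k := by
  refine StarAlgebra.adjoin_le ?_
  rintro _ ⟨i, hi, rfl⟩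
  exact Submodule.mem_sup_right (hd.mem_matrixUnitSpan hi.1 hi.2)

lemma star_mul_mul_creationWords (hu : u ∈ creationWords d n k) (hv : v ∈ creationWords d n k)
    (hx : x ∈ matrixUnitSpan d n k) : ∃ c : ℂ, star u * x * v = c • (d n * star (d n)) := by
  induction hx using Submodule.span_induction with
  | mem x hx =>
    obtain ⟨u', hu', v', hv', rfl⟩ := hx
    obtain ⟨a, ha⟩ := hd.star_mul_creationWords hu hu'
    obtain ⟨b, hb⟩ := hd.star_mul_creationWords hv' hv
    refine ⟨a * b, ?_⟩
    have h : star u * (u' * star v') * v = (star u * u') * (star v' * v) := by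
      simp only [mul_assoc]
    dsimp only
    rw [h, ha, hb, smul_mul_smul_comm, ← mul_assoc, hd.range_mul le_rfl]
  | zero => exact ⟨0, by simp⟩
  | add x y _ _ hx hy =>
    obtain ⟨a, ha⟩ := hx
    obtain ⟨b, hb⟩ := hy
    exact ⟨a + b, by rw [mul_add, add_mul, ha, hb, add_smul]⟩
  | smul c x _ hx =>
    obtain ⟨a, ha⟩ := hx
    exact ⟨c * a, by rw [mul_smul_comm, smul_mul_assoc, ha, mul_smul]⟩

variable {B : Type*} [CStarAlgebra B] {φ : R →⋆ₐ[ℂ] B}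

lemma eq_zero_of_mem_matrixUnitSpan (hφ : φ (d n * star (d n)) ≠ 0)
    (hx : x ∈ matrixUnitSpan d n k) (hx0 : φ x = 0) : x = 0 := by
  have compress : ∀ u ∈ creationWords d n k, ∀ v ∈ creationWords d n k, star u * x * v = 0 := by
    intro u hu v hv
    obtain ⟨c, hc⟩ := hd.star_mul_mul_creationWords hu hv hx
    have h := congrArg φ hc
    rw [map_mul, map_mul, hx0, mul_zero, zero_mul, map_smul, eq_comm, smul_eq_zero_iff_left hφ] at h
    rw [hc, h, zero_smul]
  have sandwich : ∀ s ∈ matrixUnitSpan d n k, ∀ t ∈ matrixUnitSpan d n k, s * x * t = 0 := by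
    intro s hs t ht
    induction hs, ht using Submodule.span_induction₂ with
    | mem_mem s t hs ht =>
      obtain ⟨u, hu, v, hv, rfl⟩ := hs
      obtain ⟨u', hu', v', hv', rfl⟩ := ht
      have h : u * star v * x * (u' * star v') = u * (star v * x * u') * star v' := by
        simp only [mul_assoc]
      dsimp only
      rw [h, compress v hv u' hu', mul_zero, zero_mul]
    | zero_left y _ => simp
    | zero_right x _ => simp
    | add_left x y z _ _ _ hx hy => rw [add_mul, add_mul, hx, hy, add_zero]
    | add_right x y z _ _ _ hx hy => rw [mul_add, hx, hy, add_zero]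
    | smul_left c x y _ _ h => rw [smul_mul_assoc, smul_mul_assoc, h, smul_zero]
    | smul_right c x y _ _ h => rw [mul_smul_comm, h, smul_zero]
  have hstar := star_mem_matrixUnitSpan hx
  have h : star (star x * x) * (star x * x) = 0 := by
    rw [star_mul, star_star, ← mul_assoc, sandwich _ hstar _ hstar, zero_mul]
  rwa [CStarRing.star_mul_self_eq_zero_iff, CStarRing.star_mul_self_eq_zero_iff] at h

lemma eq_zero_of_mem_matrixUnitAlgebra (hφ : φ (d n * star (d n)) ≠ 0)
    (hx : x ∈ hd.matrixUnitAlgebra n k) (hx0 : φ x = 0) : x = 0 := by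
  obtain ⟨c, t, ht, rfl⟩ := hd.mem_matrixUnitAlgebra.1 hx
  suffices hc : c = 0 by
    subst hc
    rw [zero_smul, zero_add] at hx0 ⊢
    exact hd.eq_zero_of_mem_matrixUnitSpan hφ ht hx0
  have hq : d n * star (d n) ∈ creationWords d n k := creationWords_mono d n k.zero_le rfl
  have hqq : star (d n * star (d n)) * (d n * star (d n)) = d n * star (d n) := by
    rw [star_mul, star_star, ← mul_assoc, hd.range_mul le_rfl]
  have annihilate : d (n - k) * t = 0 := by
    clear hx hx0
    induction ht using Submodule.span_induction with
    | mem t ht =>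
      obtain ⟨u, hu, v, hv, rfl⟩ := ht
      dsimp only
      rw [← mul_assoc, hd.mul_creationWord_eq_zero le_rfl hu, zero_mul]
    | zero => simp
    | add x y _ _ hx hy => rw [mul_add, hx, hy, add_zero]
    | smul c x _ hx => rw [mul_smul_comm, hx, smul_zero]
  have h : d (n - k) * (c • 1 + t) * (star (d (n - k)) * (d n * star (d n))) =
      c • (d n * star (d n)) := by
    rw [mul_add, annihilate, add_zero, mul_smul_comm, mul_one, smul_mul_assoc, ← mul_assoc,
      hd.range_mul_creationWord le_rfl hq]
  have h' := congrArg φ h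
  rwa [map_mul, map_mul, hx0, mul_zero, zero_mul, map_smul, eq_comm,
    smul_eq_zero_iff_left hφ] at h'

lemma norm_map_of_mem_adjoin (hφ : ∀ n, φ (d n * star (d n)) ≠ 0)
    (hx : x ∈ StarAlgebra.adjoin ℂ (Set.range d)) : ‖φ x‖ = ‖x‖ := by
  obtain ⟨N, hN⟩ := exists_mem_adjoin_image_Ioc hx
  have hV := hd.adjoin_le_matrixUnitAlgebra _ _ hN
  have := hd.isClosed_matrixUnitAlgebra N (2 * N)
  let ψ : hd.matrixUnitAlgebra N (2 * N) →⋆ₐ[ℂ] B := φ.comp (StarSubalgebra.subtype _)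
  refine NonUnitalStarAlgHom.norm_map ψ ?_ ⟨x, hV⟩
  rw [injective_iff_map_eq_zero]
  exact fun y hy => Subtype.ext (hd.eq_zero_of_mem_matrixUnitAlgebra (hφ _) y.2 hy)

lemma norm_map_of_mem_topologicalClosure (hφ : ∀ n, φ (d n * star (d n)) ≠ 0)
    (hx : x ∈ (StarAlgebra.adjoin ℂ (Set.range d)).topologicalClosure) : ‖φ x‖ = ‖x‖ := by
  have hcont : Continuous φ := AddMonoidHomClass.continuous_of_bound φ 1 fun y => by
    simpa using NonUnitalStarAlgHom.norm_apply_le φ y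
  refine closure_minimal (s := (StarAlgebra.adjoin ℂ (Set.range d) : Set R))
    (t := {x | ‖φ x‖ = ‖x‖}) (fun y hy => hd.norm_map_of_mem_adjoin hφ hy)
    (isClosed_eq hcont.norm continuous_norm) hx

end MonotoneRules

end CreationWords

lemma eS_apply (S T : Finset ℤ) : (eS S : MF) T = if T = S then 1 else 0 := by
  rw [eS, lp.single_apply, Pi.single_apply]

lemma ite_eS_apply (p : Prop) [Decidable p] (S T : Finset ℤ) :
    (if p then eS S else 0 : MF) T = if p ∧ T = S then 1 else 0 := by
  by_cases p <;> simp [eS_apply, *]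

lemma inner_eS_left (S : Finset ℤ) (f : MF) : ⟪eS S, f⟫_ℂ = f S := by
  simpa using! lp.inner_single_left (𝕜 := ℂ) S (1 : ℂ) f

lemma inner_eS_right (S : Finset ℤ) (f : MF) : ⟪f, eS S⟫_ℂ = star (f S) := by
  rw [← inner_eS_left, ← starRingEnd_apply, inner_conj_symm]

lemma ext_eS {f g : MF →L[ℂ] MF} (h : ∀ S, f (eS S) = g (eS S)) : f = g := by
  refine lp.ext_continuousLinearMap ENNReal.ofNat_ne_top fun S => ?_
  ext1
  exact h S

lemma eS_ne_zero (S : Finset ℤ) : eS S ≠ 0 := fun h => by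
  simpa [eS_apply] using congrArg (fun f : MF => f S) h

namespace IsMonotoneAnnihilation

variable {a : ℤ → MF →L[ℂ] MF} (ha : IsMonotoneAnnihilation a)
include ha

lemma apply_eS (i : ℤ) (S : Finset ℤ) :
    a i (eS S) = if i ∈ S ∧ ∀ j ∈ S, i ≤ j then eS (S.erase i) else 0 := by
  have hmin : S.min = (i : WithTop ℤ) ↔ i ∈ S ∧ ∀ j ∈ S, i ≤ j := by
    refine ⟨fun h => ⟨Finset.mem_of_min h, fun j hj => ?_⟩, fun h => ?_⟩
    · have := Finset.min_le hj
      rw [h] at this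
      exact WithTop.coe_le_coe.1 this
    · exact le_antisymm (Finset.min_le h.1)
        (Finset.le_min fun j hj => WithTop.coe_le_coe.2 (h.2 j hj))
  split_ifs with h
  · exact (ha i S).1 (hmin.2 h)
  · exact (ha i S).2 fun h' => h (hmin.1 h')

lemma star_apply_eS (i : ℤ) (S : Finset ℤ) :
    star (a i) (eS S) = if ∀ j ∈ S, i < j then eS (insert i S) else 0 := by
  ext T
  rw [← inner_eS_left, star_eq_adjoint, adjoint_inner_right, inner_eS_right, ha.apply_eS]
  have key : (∀ j ∈ S, i < j) ∧ T = insert i S ↔ (i ∈ T ∧ ∀ j ∈ T, i ≤ j) ∧ S = T.erase i := by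
    constructor
    · rintro ⟨hS, rfl⟩
      have hi : i ∉ S := fun hi => (hS i hi).false
      refine ⟨⟨by simp, fun j hj => ?_⟩, by simp [hi]⟩
      obtain rfl | hj := Finset.mem_insert.1 hj
      exacts [le_rfl, (hS j hj).le]
    · rintro ⟨⟨hi, hT⟩, rfl⟩
      refine ⟨fun j hj => ?_, by simp [hi]⟩
      exact (hT j (Finset.mem_of_mem_erase hj)).lt_of_ne (Finset.ne_of_mem_erase hj).symm
  simp only [ite_eS_apply, ← key]
  split_ifs <;> simp

lemma range_apply_eS (i : ℤ) (S : Finset ℤ) :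
    (a i * star (a i)) (eS S) = if ∀ j ∈ S, i < j then eS S else 0 := by
  rw [mul_apply_eq_comp, ha.star_apply_eS]
  split_ifs with h
  · have hi : i ∉ S := fun hi => (h i hi).false
    rw [ha.apply_eS, if_pos, Finset.erase_insert hi]
    simp only [Finset.mem_insert, true_or, forall_eq_or_imp, le_refl, true_and]
    exact fun j hj => (h j hj).le
  · simp

lemma source_apply_eS (i : ℤ) (S : Finset ℤ) :
    (star (a i) * a i) (eS S) = if i ∈ S ∧ ∀ j ∈ S, i ≤ j then eS S else 0 := by
  rw [mul_apply_eq_comp, ha.apply_eS]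
  split_ifs with h
  · rw [ha.star_apply_eS, if_pos, Finset.insert_erase h.1]
    exact fun j hj => (h.2 j (Finset.mem_of_mem_erase hj)).lt_of_ne
      (Finset.ne_of_mem_erase hj).symm
  · simp

lemma monotoneRules : MonotoneRules a where
  mul_eq_zero {i j} hij := ext_eS fun S => by
    rw [mul_apply_eq_comp, ha.apply_eS]
    split_ifs with h
    · rw [ha.apply_eS, if_neg]
      · rfl
      · rintro ⟨h', -⟩
        have := h.2 i (Finset.mem_of_mem_erase h')
        exact Finset.ne_of_mem_erase h' (by lia)
    · simp
  range_mul_star {i j} hij := ext_eS fun S => by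
    rw [mul_apply_eq_comp, ha.star_apply_eS]
    split_ifs with h
    · rw [ha.range_apply_eS, if_pos]
      simp only [Finset.mem_insert, forall_eq_or_imp]
      exact ⟨hij, fun k hk => hij.trans (h k hk)⟩
    · simp
  range_mul {i j} hij := ext_eS fun S => by
    rw [mul_apply_eq_comp, ha.apply_eS]
    split_ifs with h
    · rw [ha.range_apply_eS, if_pos]
      intro k hk
      have := h.2 k (Finset.mem_of_mem_erase hk)
      have := Finset.ne_of_mem_erase hk
      lia
    · simp
  source_add_range i := ext_eS fun S => by
    rw [add_apply, ha.source_apply_eS, ha.range_apply_eS, ha.range_apply_eS]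
    by_cases h : ∀ j ∈ S, i - 1 < j
    · have hle : ∀ j ∈ S, i ≤ j := fun j hj => by have := h j hj; lia
      rw [if_pos h]
      by_cases hi : i ∈ S
      · rw [if_pos ⟨hi, hle⟩, if_neg fun h' => (h' i hi).false, add_zero]
      · rw [if_neg fun h' => hi h'.1, if_pos, zero_add]
        exact fun j hj => (hle j hj).lt_of_ne fun h' => hi (h' ▸ hj)
    · rw [if_neg h, if_neg, if_neg, add_zero]
      · exact fun h' => h fun j hj => by have := h' j hj; lia
      · exact fun h' => h fun j hj => by have := h'.2 j hj; lia

lemma range_ne_zero (i : ℤ) : a i * star (a i) ≠ 0 := fun h => by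
  have := ha.range_apply_eS i ∅
  rw [h] at this
  exact eS_ne_zero ∅ (by simpa using this.symm)

end IsMonotoneAnnihilation

lemma MonotoneRules.prodMk {R A : Type*} [CStarAlgebra R] [CStarAlgebra A] {d : ℤ → R}
    {c : ℤ → A} (hd : MonotoneRules d) (hc : MonotoneRules c) :
    MonotoneRules fun i => (d i, c i) where
  mul_eq_zero h := Prod.ext (hd.mul_eq_zero h) (hc.mul_eq_zero h)
  range_mul_star h := Prod.ext (hd.range_mul_star h) (hc.range_mul_star h)
  range_mul h := Prod.ext (hd.range_mul h) (hc.range_mul h)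
  source_add_range i := Prod.ext (hd.source_add_range i) (hc.source_add_range i)

/-- If the projections `d n * star (d n)` do not vanish, then the C*-algebra generated by `d` maps
contractively to any other C*-algebra with generators satisfying the monotone rules. -/
lemma MonotoneRules.exists_starAlgHom {R A : Type*} [CStarAlgebra R] [CStarAlgebra A]
    {d : ℤ → R} {c : ℤ → A} (hd : MonotoneRules d) (hc : MonotoneRules c)
    (hd0 : ∀ n, d n * star (d n) ≠ 0) :
    ∃ Φ : (StarAlgebra.adjoin ℂ (Set.range d)).topologicalClosure →⋆ₐ[ℂ] A,
      Continuous Φ ∧ ∀ i h, Φ ⟨d i, h⟩ = c i := by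
  set D := (StarAlgebra.adjoin ℂ (Set.range fun i => (d i, c i))).topologicalClosure
  let ψ : D →⋆ₐ[ℂ] R := (StarAlgHom.fst ℂ R A).comp D.subtype
  have hnorm (x : D) : ‖ψ x‖ = ‖x‖ :=
    (hd.prodMk hc).norm_map_of_mem_topologicalClosure (φ := StarAlgHom.fst ℂ R A) hd0 x.2
  have hiso : Isometry ψ := AddMonoidHomClass.isometry_of_norm ψ hnorm
  have hmem (i : ℤ) : (d i, c i) ∈ D :=
    StarSubalgebra.le_topologicalClosure _ (StarAlgebra.subset_adjoin ℂ _ ⟨i, rfl⟩)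
  have hDclosed : IsClosed (D : Set (R × A)) := StarSubalgebra.isClosed_topologicalClosure _
  have := hDclosed.completeSpace_coe
  have hle : (StarAlgebra.adjoin ℂ (Set.range d)).topologicalClosure ≤ ψ.range := by
    refine StarSubalgebra.topologicalClosure_minimal (StarAlgebra.adjoin_le ?_)
      hiso.isClosedEmbedding.isClosed_range
    rintro _ ⟨i, rfl⟩
    exact ⟨⟨_, hmem i⟩, rfl⟩
  let e : D ≃⋆ₐ[ℂ] ψ.range := StarAlgEquiv.ofInjective ψ hiso.injective
  have he (y : ψ.range) : ‖(e.symm y : R × A)‖ = ‖y‖ := by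
    obtain ⟨x, rfl⟩ := e.surjective y
    exact (congrArg (fun z : D => ‖z‖) (e.symm_apply_apply x)).trans (hnorm x).symm
  let Φ := ((StarAlgHom.snd ℂ R A).comp (D.subtype.comp (e.symm : ψ.range →⋆ₐ[ℂ] D))).comp
    (StarSubalgebra.inclusion hle)
  refine ⟨Φ, AddMonoidHomClass.continuous_of_bound Φ 1 fun y => ?_, fun i h => ?_⟩
  · rw [one_mul]
    exact (_root_.norm_snd_le _).trans_eq (he _)
  · have hsymm : e.symm (StarSubalgebra.inclusion hle ⟨d i, h⟩) = ⟨_, hmem i⟩ :=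
      e.symm_apply_eq.2 rfl
    exact congrArg (fun x : D => (x : R × A).2) hsymm

/-- Universality of the monotone C*-algebra: for any unital C*-algebra `A` and any family
`c : ℤ → A` satisfying the monotone rules, there is a unique continuous unital
star-algebra homomorphism `Φ : 𝔐 → A` with `Φ (a i) = c i` for all `i`. -/
theorem stmt6 (a : ℤ → MF →L[ℂ] MF) (ha : IsMonotoneAnnihilation a)
    (A : Type) [NormedRing A] [StarRing A] [CStarRing A] [NormedAlgebra ℂ A]
    [CompleteSpace A] [StarModule ℂ A]
    (c : ℤ → A)
    (h1 : ∀ i j : ℤ, i ≤ j → c i * c j = 0)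
    (h2 : ∀ i j : ℤ, (i > j → c i * c j * star (c j) = c i) ∧
      (i ≤ j → c i * c j * star (c j) = 0))
    (h3 : ∀ i : ℤ, star (c i) * c i = c (i - 1) * star (c (i - 1)) - c i * star (c i))
    (h4 : ∀ i j : ℤ,
      (i > j → c i * star (c i) * c j =
        c j - ∑ k ∈ Finset.Icc (j + 1) i, star (c k) * c k * c j) ∧
      (i ≤ j → c i * star (c i) * c j = c j)) :
    ∃! Φ : ↥(MonM a) →⋆ₐ[ℂ] A,
      Continuous Φ ∧ ∀ i : ℤ, Φ ⟨a i, a_mem_MonM a i⟩ = c i := by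
  let _ : CStarAlgebra A := { }
  have hc : MonotoneRules c :=
    { mul_eq_zero := fun {i j} h => h1 i j h
      range_mul_star := fun {i j} h => by
        simpa [mul_assoc] using congrArg star ((h2 i j).1 h)
      range_mul := fun {i j} h => (h4 i j).2 h
      source_add_range := fun i => by rw [h3, sub_add_cancel] }
  obtain ⟨Φ, hΦ, hΦc⟩ := ha.monotoneRules.exists_starAlgHom hc ha.range_ne_zero
  refine ⟨Φ, ⟨hΦ, fun i => hΦc i _⟩, fun Ψ ⟨hΨ, hΨc⟩ => ?_⟩
  refine StarAlgHom.ext_topologicalClosure hΨ hΦ (StarAlgHom.ext_adjoin ?_)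
  rintro ⟨_, _⟩ ⟨i, rfl⟩
  exact (hΨc i).trans (hΦc i _).symm
end
end

section
/- The non-unital monotone C*-algebra 𝔦 is simple: every norm-closed two-sided ideal of 𝔦 equals {0} or 𝔦. -/
noncomputable section

open ContinuousLinearMap
open scoped InnerProductSpace ComplexOrder

/-- The non-unital monotone C*-algebra `𝔦`: the norm-closed star-subalgebra of `B(F)`
generated by the annihilation operators. -/
noncomputable def MonI (a : ℤ → MF →L[ℂ] MF) : NonUnitalStarSubalgebra ℂ (MF →L[ℂ] MF) :=
  (NonUnitalStarAlgebra.adjoin ℂ (Set.range a)).topologicalClosure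

theorem inner_eS (S : Finset ℤ) (v : MF) : ⟪eS S, v⟫_ℂ = v S := by
  simp [eS, lp.inner_single_left]

theorem inner_eS_eS (S T : Finset ℤ) : ⟪eS S, eS T⟫_ℂ = if S = T then 1 else 0 := by
  rw [inner_eS, eS, lp.single_apply]
  by_cases h : S = T
  · subst h; simp
  · simp [h]

theorem norm_eS (S : Finset ℤ) : ‖eS S‖ = 1 := by
  have h := inner_self_eq_norm_sq_to_K (𝕜 := ℂ) (eS S)
  rw [inner_eS_eS, if_pos rfl] at h
  have h' : ‖eS S‖ ^ 2 = 1 := by rw [← Complex.ofReal_inj]; push_cast; exact h.symm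
  nlinarith [norm_nonneg (eS S)]

theorem ext_inner_eS {v w : MF} (h : ∀ S, ⟪eS S, v⟫_ℂ = ⟪eS S, w⟫_ℂ) : v = w := by
  ext S
  simpa [inner_eS] using h S

theorem clm_ext_eS {T R : MF →L[ℂ] MF} (h : ∀ S, T (eS S) = R (eS S)) : T = R := by
  have : adjoint T = adjoint R := by
    ext1 v
    refine ext_inner_eS fun S => ?_
    rw [adjoint_inner_right, adjoint_inner_right, h]
  simpa using congrArg adjoint this

namespace IsMonotoneAnnihilation

variable {a : ℤ → MF →L[ℂ] MF}

theorem apply_insert (ha : IsMonotoneAnnihilation a) {i : ℤ} {S : Finset ℤ}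
    (h : ∀ s ∈ S, i < s) : a i (eS (insert i S)) = eS S := by
  have hi : i ∉ S := fun hi => lt_irrefl _ (h i hi)
  rw [(ha i (insert i S)).1, Finset.erase_insert hi]
  refine le_antisymm (Finset.min_le (Finset.mem_insert_self _ _)) (Finset.le_min fun b hb => ?_)
  rcases Finset.mem_insert.1 hb with rfl | hb
  · exact le_rfl
  · exact WithTop.coe_le_coe.2 (h b hb).le

theorem apply_eq_zero (ha : IsMonotoneAnnihilation a) {i : ℤ} {S : Finset ℤ}
    (h : ¬ (i ∈ S ∧ ∀ s ∈ S, i ≤ s)) : a i (eS S) = 0 := by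
  refine (ha i S).2 fun hm => h ⟨Finset.mem_of_min hm, fun s hs => Finset.min_le_of_eq hs hm⟩

/-- Every basis vector either is killed by `a i` or is obtained by adding `i` below a set. -/
theorem eq_insert_or_apply_eq_zero (ha : IsMonotoneAnnihilation a) (i : ℤ) (S : Finset ℤ) :
    (∃ T, (∀ t ∈ T, i < t) ∧ S = insert i T) ∨ a i (eS S) = 0 := by
  by_cases h : i ∈ S ∧ ∀ s ∈ S, i ≤ s
  · refine Or.inl ⟨S.erase i, fun t ht => ?_, (Finset.insert_erase h.1).symm⟩
    rw [Finset.mem_erase] at ht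
    exact lt_of_le_of_ne (h.2 t ht.2) (Ne.symm ht.1)
  · exact Or.inr (ha.apply_eq_zero h)

theorem star_apply (ha : IsMonotoneAnnihilation a) {i : ℤ} {S : Finset ℤ}
    (h : ∀ s ∈ S, i < s) : star (a i) (eS S) = eS (insert i S) := by
  refine ext_inner_eS fun V => ?_
  rw [star_eq_adjoint, adjoint_inner_right, inner_eS_eS]
  have hi : i ∉ S := fun hi => lt_irrefl _ (h i hi)
  rcases ha.eq_insert_or_apply_eq_zero i V with ⟨T, hT, rfl⟩ | h0
  · rw [ha.apply_insert hT, inner_eS_eS]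
    have hiT : i ∉ T := fun hi => lt_irrefl _ (hT i hi)
    congr 1
    refine propext ⟨fun e => by rw [e], fun e => ?_⟩
    rw [← Finset.erase_insert hiT, e, Finset.erase_insert hi]
  · rw [h0, inner_zero_left, if_neg]
    rintro rfl
    rw [ha.apply_insert h] at h0
    simpa [h0] using norm_eS S

theorem star_apply_eq_zero (ha : IsMonotoneAnnihilation a) {i : ℤ} {S : Finset ℤ}
    (h : ¬ ∀ s ∈ S, i < s) : star (a i) (eS S) = 0 := by
  refine ext_inner_eS fun V => ?_
  rw [star_eq_adjoint, adjoint_inner_right, inner_zero_right]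
  rcases ha.eq_insert_or_apply_eq_zero i V with ⟨T, hT, rfl⟩ | h0
  · rw [ha.apply_insert hT, inner_eS_eS, if_neg]
    rintro rfl
    exact h hT
  · rw [h0, inner_zero_left]

/-- `a n * star (a n)` is the projection onto the span of the `eS S` with `n` below `S`. -/
theorem mul_star_apply (ha : IsMonotoneAnnihilation a) (n : ℤ) (S : Finset ℤ) :
    (a n * star (a n)) (eS S) = if ∀ s ∈ S, n < s then eS S else 0 := by
  split_ifs with h
  · rw [mul_apply_eq_comp, ha.star_apply h, ha.apply_insert h]
  · rw [mul_apply_eq_comp, ha.star_apply_eq_zero h, map_zero]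

theorem mul_star_mul_mul_star (ha : IsMonotoneAnnihilation a) {m n : ℤ} (h : m ≤ n) :
    (a m * star (a m)) * (a n * star (a n)) = a n * star (a n) := by
  refine clm_ext_eS fun S => ?_
  rw [mul_apply_eq_comp, ha.mul_star_apply n]
  split_ifs with hS
  · rw [ha.mul_star_apply, if_pos fun s hs => h.trans_lt (hS s hs)]
  · rw [map_zero]

theorem norm_mul_star_le (ha : IsMonotoneAnnihilation a) (n : ℤ) :
    ‖a n * star (a n)‖ ≤ 1 := by
  have h : ‖a n * star (a n)‖ = ‖a n * star (a n)‖ * ‖a n * star (a n)‖ := by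
    conv_lhs => rw [← ha.mul_star_mul_mul_star le_rfl]
    conv_rhs => rw [← CStarRing.norm_star_mul_self]
    rw [star_mul, star_star]
  by_contra! h1
  nlinarith

theorem mul_star_mul (ha : IsMonotoneAnnihilation a) {m i : ℤ} (h : m ≤ i) :
    (a m * star (a m)) * a i = a i := by
  refine clm_ext_eS fun S => ?_
  rw [mul_apply_eq_comp]
  rcases ha.eq_insert_or_apply_eq_zero i S with ⟨T, hT, rfl⟩ | h0
  · rw [ha.apply_insert hT, ha.mul_star_apply, if_pos fun s hs => h.trans_lt (hT s hs)]
  · rw [h0, map_zero]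

theorem mul_star_mul_star (ha : IsMonotoneAnnihilation a) {m i : ℤ} (h : m < i) :
    (a m * star (a m)) * star (a i) = star (a i) := by
  refine clm_ext_eS fun S => ?_
  rw [mul_apply_eq_comp]
  by_cases hS : ∀ s ∈ S, i < s
  · rw [ha.star_apply hS, ha.mul_star_apply, if_pos]
    intro s hs
    rcases Finset.mem_insert.1 hs with rfl | hs
    exacts [h, h.trans (hS s hs)]
  · rw [ha.star_apply_eq_zero hS, map_zero]

theorem mul_star_sub_one (ha : IsMonotoneAnnihilation a) (n : ℤ) :
    a (n - 1) * star (a (n - 1)) = a n * star (a n) + star (a n) * a n := by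
  refine clm_ext_eS fun S => ?_
  rw [add_apply, ha.mul_star_apply, ha.mul_star_apply, mul_apply_eq_comp]
  rcases ha.eq_insert_or_apply_eq_zero n S with ⟨T, hT, rfl⟩ | h0
  · rw [ha.apply_insert hT, ha.star_apply hT, if_neg (c := ∀ s ∈ insert n T, n < s), zero_add,
      if_pos]
    · intro s hs
      rcases Finset.mem_insert.1 hs with rfl | hs
      · omega
      · have := hT s hs
        omega
    · exact fun h => lt_irrefl _ (h n (Finset.mem_insert_self _ _))
  · rw [h0, map_zero, add_zero]
    congr 1
    refine propext ⟨fun h s hs => ?_, fun h s hs => ?_⟩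
    · have h1 := h s hs
      rcases (show n = s ∨ n < s by omega) with rfl | h2
      · exfalso
        have hi : n ∈ S ∧ ∀ s ∈ S, n ≤ s := ⟨hs, fun t ht => by have := h t ht; omega⟩
        have h3 := ha.apply_insert (i := n) (S := S.erase n) (fun t ht => by
          rw [Finset.mem_erase] at ht
          exact lt_of_le_of_ne (hi.2 t ht.2) (Ne.symm ht.1))
        rw [Finset.insert_erase hs, h0] at h3
        simpa [← h3] using norm_eS (S.erase n)
      · exact h2
    · have := h s hs
      omega

theorem adjoin_induction_star (a : ℤ → MF →L[ℂ] MF) {p : (MF →L[ℂ] MF) → Prop}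
    (gen : ∀ i, p (a i)) (gen_star : ∀ i, p (star (a i))) (zero : p 0)
    (add : ∀ x y, p x → p y → p (x + y)) (smul : ∀ (c : ℂ) x, p x → p (c • x))
    (mul : ∀ x y, p x → p y → p (x * y)) {x : MF →L[ℂ] MF}
    (hx : x ∈ NonUnitalStarAlgebra.adjoin ℂ (Set.range a)) : p x := by
  have hx' : x ∈ NonUnitalAlgebra.adjoin ℂ (Set.range a ∪ star (Set.range a)) := hx
  refine NonUnitalAlgebra.adjoin_induction (p := fun y _ => p y) ?_ (fun x y _ _ => add x y) zero
    (fun x y _ _ => mul x y) (fun c x _ => smul c x) hx'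
  rintro y (⟨i, rfl⟩ | ⟨i, hi⟩)
  · exact gen i
  · rw [← star_star y, ← hi]
    exact gen_star i

theorem exists_mul_star_mul_eq (ha : IsMonotoneAnnihilation a) {x : MF →L[ℂ] MF}
    (hx : x ∈ NonUnitalStarAlgebra.adjoin ℂ (Set.range a)) :
    ∃ m, (a m * star (a m)) * x = x := by
  suffices h : ∃ m, ∀ k ≤ m, (a k * star (a k)) * x = x from
    h.imp fun m hm => hm m le_rfl
  refine adjoin_induction_star a (p := fun x => ∃ m, ∀ k ≤ m, (a k * star (a k)) * x = x)
    (fun i => ⟨i, fun k hk => ha.mul_star_mul hk⟩)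
    (fun i => ⟨i - 1, fun k hk => ha.mul_star_mul_star (by omega)⟩)
    ⟨0, fun k _ => mul_zero _⟩ ?_ ?_ ?_ hx
  · rintro x y ⟨m, hm⟩ ⟨n, hn⟩
    refine ⟨min m n, fun k hk => ?_⟩
    rw [mul_add, hm k (hk.trans (min_le_left _ _)), hn k (hk.trans (min_le_right _ _))]
  · rintro c x ⟨m, hm⟩
    exact ⟨m, fun k hk => by rw [mul_smul_comm, hm k hk]⟩
  · rintro x y ⟨m, hm⟩ -
    exact ⟨m, fun k hk => by rw [← mul_assoc, hm k hk]⟩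

/-- The families `U ↦ ∑ c_A • eS (A ∪ U)`, where the `A` are bounded above by `n` and `U` runs
over the sets above `n`. -/
def shiftSpan (n : ℤ) : Submodule ℂ ({U : Finset ℤ // ∀ u ∈ U, n < u} → MF) :=
  Submodule.span ℂ {v | ∃ A : Finset ℤ, (∀ i ∈ A, i ≤ n) ∧ v = fun U => eS (A ∪ U.1)}

theorem exists_preserves_shiftSpan (ha : IsMonotoneAnnihilation a) {x : MF →L[ℂ] MF}
    (hx : x ∈ NonUnitalStarAlgebra.adjoin ℂ (Set.range a)) :
    ∃ N, ∀ n ≥ N, ∀ v ∈ shiftSpan n, (fun U => x (v U)) ∈ shiftSpan n := by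
  refine adjoin_induction_star a
    (p := fun x => ∃ N, ∀ n ≥ N, ∀ v ∈ shiftSpan n, (fun U => x (v U)) ∈ shiftSpan n)
    (fun i => ⟨i, fun n hn v hv => ?_⟩) (fun i => ⟨i, fun n hn v hv => ?_⟩)
    ⟨0, fun n _ v _ => ?_⟩ ?_ ?_ ?_ hx
  · suffices h : shiftSpan n ≤ (shiftSpan n).comap ((a i).toLinearMap.compLeft _) from h hv
    refine Submodule.span_le.2 ?_
    rintro _ ⟨A, hA, rfl⟩
    change (fun U : {U : Finset ℤ // ∀ u ∈ U, n < u} => a i (eS (A ∪ U))) ∈ shiftSpan n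
    by_cases h : i ∈ A ∧ ∀ s ∈ A, i ≤ s
    · refine Submodule.subset_span ⟨A.erase i, fun j hj => hA j (Finset.mem_of_mem_erase hj), ?_⟩
      ext1 U
      conv_lhs => rw [← Finset.insert_erase h.1, Finset.insert_union]
      refine ha.apply_insert fun s hs => ?_
      rcases Finset.mem_union.1 hs with hs | hs
      · rw [Finset.mem_erase] at hs
        exact lt_of_le_of_ne (h.2 s hs.2) (Ne.symm hs.1)
      · exact lt_of_le_of_lt hn (U.2 s hs)
    · convert (shiftSpan n).zero_mem using 1
      ext1 U
      refine ha.apply_eq_zero fun hU => h ⟨?_, fun s hs => hU.2 s (Finset.mem_union_left _ hs)⟩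
      exact (Finset.mem_union.1 hU.1).resolve_right fun hi => absurd (U.2 i hi) (by omega)
  · suffices h : shiftSpan n ≤ (shiftSpan n).comap ((star (a i)).toLinearMap.compLeft _) from h hv
    refine Submodule.span_le.2 ?_
    rintro _ ⟨A, hA, rfl⟩
    change (fun U : {U : Finset ℤ // ∀ u ∈ U, n < u} => star (a i) (eS (A ∪ U))) ∈ shiftSpan n
    by_cases h : ∀ s ∈ A, i < s
    · refine Submodule.subset_span ⟨insert i A, fun j hj => ?_, ?_⟩
      · rcases Finset.mem_insert.1 hj with rfl | hj
        exacts [hn, hA j hj]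
      ext1 U
      rw [Finset.insert_union]
      refine ha.star_apply fun s hs => ?_
      rcases Finset.mem_union.1 hs with hs | hs
      exacts [h s hs, lt_of_le_of_lt hn (U.2 s hs)]
    · convert (shiftSpan n).zero_mem using 1
      ext1 U
      exact ha.star_apply_eq_zero fun hU => h fun s hs => hU s (Finset.mem_union_left _ hs)
  · exact (shiftSpan n).zero_mem
  · rintro x y ⟨M, hM⟩ ⟨N, hN⟩
    exact ⟨max M N, fun n hn v hv => (shiftSpan n).add_mem
      (hM n ((le_max_left _ _).trans hn) v hv) (hN n ((le_max_right _ _).trans hn) v hv)⟩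
  · rintro c x ⟨N, hN⟩
    exact ⟨N, fun n hn v hv => (shiftSpan n).smul_mem c (hN n hn v hv)⟩
  · rintro x y ⟨M, hM⟩ ⟨N, hN⟩
    exact ⟨max M N, fun n hn v hv => hM n ((le_max_left _ _).trans hn) _
      (hN n ((le_max_right _ _).trans hn) v hv)⟩

theorem mem_monI (a : ℤ → MF →L[ℂ] MF) (i : ℤ) : a i ∈ MonI a :=
  NonUnitalStarSubalgebra.le_topologicalClosure _
    (NonUnitalStarAlgebra.subset_adjoin ℂ _ ⟨i, rfl⟩)

theorem mul_star_mem_monI (a : ℤ → MF →L[ℂ] MF) (i : ℤ) : a i * star (a i) ∈ MonI a :=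
  mul_mem (mem_monI a i) (star_mem (mem_monI a i))

/-- The product of the creation operators indexed by `B`, in the order that does not annihilate
the vacuum. -/
theorem exists_creation (ha : IsMonotoneAnnihilation a) (B : Finset ℤ) :
    ∃ W : MF →L[ℂ] MF, (∀ n, W * (a n * star (a n)) ∈ MonI a) ∧
      ∀ U : Finset ℤ, (∀ b ∈ B, ∀ u ∈ U, b < u) → W (eS U) = eS (B ∪ U) := by
  induction B using Finset.induction_on_min with
  | empty => exact ⟨1, fun n => by simpa using mul_star_mem_monI a n, fun U _ => by simp⟩
  | insert i B hB ih =>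
    obtain ⟨W, hW, hU⟩ := ih
    refine ⟨star (a i) * W, fun n => ?_, fun U h => ?_⟩
    · rw [mul_assoc]
      exact mul_mem (star_mem (mem_monI a i)) (hW n)
    · rw [mul_apply_eq_comp, hU U fun b hb => h b (Finset.mem_insert_of_mem hb), Finset.insert_union]
      refine ha.star_apply fun s hs => ?_
      rcases Finset.mem_union.1 hs with hs | hs
      exacts [hB s hs, h i (Finset.mem_insert_self _ _) s hs]

theorem union_eq_union_iff {n : ℤ} {A B U V : Finset ℤ} (hA : ∀ i ∈ A, i ≤ n)
    (hB : ∀ i ∈ B, i ≤ n) (hU : ∀ u ∈ U, n < u) (hV : ∀ u ∈ V, n < u) :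
    A ∪ U = B ∪ V ↔ A = B ∧ U = V := by
  refine ⟨fun h => ⟨?_, ?_⟩, fun h => by rw [h.1, h.2]⟩
  all_goals
    ext j
    have h1 := Finset.ext_iff.1 h j
    simp only [Finset.mem_union] at h1
    have := hA j
    have := hB j
    have := hU j
    have := hV j
    by_cases hj : j ≤ n
    · have : ¬ n < j := by omega
      tauto
    · tauto

theorem compress_eq (ha : IsMonotoneAnnihilation a) {n : ℤ} {A B : Finset ℤ}
    (hA : ∀ i ∈ A, i ≤ n) (hB : ∀ i ∈ B, i ≤ n) {V W x : MF →L[ℂ] MF}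
    (hV : ∀ U : Finset ℤ, (∀ b ∈ A, ∀ u ∈ U, b < u) → V (eS U) = eS (A ∪ U))
    (hW : ∀ U : Finset ℤ, (∀ b ∈ B, ∀ u ∈ U, b < u) → W (eS U) = eS (B ∪ U))
    (hx : ∀ v ∈ shiftSpan n, (fun U => x (v U)) ∈ shiftSpan n) :
    star (V * (a n * star (a n))) * x * (W * (a n * star (a n))) =
      ⟪eS A, x (eS B)⟫_ℂ • (a n * star (a n)) := by
  have key : ∀ v ∈ shiftSpan n, ∀ U : {U : Finset ℤ // ∀ u ∈ U, n < u},
      star (V * (a n * star (a n))) (v U) = ⟪eS A, v ⟨∅, by simp⟩⟫_ℂ • eS U := by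
    intro v hv U
    induction hv using Submodule.span_induction with
    | mem v hv =>
      obtain ⟨C, hC, rfl⟩ := hv
      refine ext_inner_eS fun R => ?_
      rw [star_eq_adjoint, adjoint_inner_right, mul_apply_eq_comp, ha.mul_star_apply, inner_smul_right]
      simp only [Finset.union_empty, inner_eS_eS]
      by_cases hR : ∀ r ∈ R, n < r
      · rw [if_pos hR, hV R fun b hb u hu => (hA b hb).trans_lt (hR u hu), inner_eS_eS]
        simp only [union_eq_union_iff hA hC hR U.2, ite_and, mul_ite, mul_one, mul_zero]
        split_ifs <;> rfl
      · have hRU : R ≠ U.1 := fun h => hR (h ▸ U.2)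
        simp [hR, hRU]
    | zero => simp
    | add v w _ _ hv hw => simp only [Pi.add_apply, map_add, hv, hw, inner_add_right, add_smul]
    | smul c v _ hv => simp only [Pi.smul_apply, map_smul, hv, inner_smul_right, mul_smul]
  refine clm_ext_eS fun U => ?_
  rw [mul_apply_eq_comp, mul_apply_eq_comp, mul_apply_eq_comp, smul_apply, ha.mul_star_apply]
  split_ifs with hU
  · rw [hW U fun b hb u hu => (hB b hb).trans_lt (hU u hu)]
    have := key _ (hx _ (Submodule.subset_span ⟨B, hB, rfl⟩)) ⟨U, hU⟩
    simpa using this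
  · simp

end IsMonotoneAnnihilation

open IsMonotoneAnnihilation

theorem exists_inner_eS_ne_zero {x : MF →L[ℂ] MF} (hx : x ≠ 0) :
    ∃ A B, ⟪eS A, x (eS B)⟫_ℂ ≠ 0 := by
  by_contra! h
  exact hx (clm_ext_eS fun B => ext_inner_eS fun A => by simp [h A B])

/-- Near every nonzero element of a closed ideal one finds a multiple of a vacuum-type projection,
up to compression; hence the ideal contains such a projection. -/
theorem exists_mul_star_mem {a : ℤ → MF →L[ℂ] MF} (ha : IsMonotoneAnnihilation a)
    {I : TwoSidedIdeal ↥(MonI a)} (hI : IsClosed (I : Set ↥(MonI a)))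
    {x : ↥(MonI a)} (hxI : x ∈ I) (hx : x ≠ 0) :
    ∃ n, (⟨a n * star (a n), mul_star_mem_monI a n⟩ : ↥(MonI a)) ∈ I := by
  obtain ⟨A, B, hc⟩ := exists_inner_eS_ne_zero (x := x.1) fun h => hx (Subtype.ext h)
  set c := ⟪eS A, x.1 (eS B)⟫_ℂ with hcdef
  obtain ⟨V, hVm, hV⟩ := ha.exists_creation A
  obtain ⟨W, hWm, hW⟩ := ha.exists_creation B
  have hK : 0 < ‖V‖ * ‖W‖ + 1 := by positivity
  obtain ⟨b, hb, hxb⟩ : ∃ b ∈ NonUnitalStarAlgebra.adjoin ℂ (Set.range a),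
      dist x.1 b < ‖c‖ / (‖V‖ * ‖W‖ + 1) :=
    Metric.mem_closure_iff.1 (show x.1 ∈ closure _ from x.2) _ (by positivity)
  rw [dist_eq_norm, lt_div_iff₀ hK] at hxb
  obtain ⟨N, hN⟩ := ha.exists_preserves_shiftSpan hb
  obtain ⟨M, hM⟩ := (N :: (A ∪ B).toList).toFinset.bddAbove
  have hM' : ∀ j, (j = N ∨ j ∈ A ∨ j ∈ B) → j ≤ M := fun j hj => hM (by simpa using hj)
  refine ⟨M, ?_⟩
  have hcomp := ha.compress_eq (fun i hi => hM' i (by tauto)) (fun i hi => hM' i (by tauto))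
    hV hW (hN M (hM' N (by tauto)))
  set P := a M * star (a M) with hP
  have hP1 : ‖P‖ ≤ 1 := ha.norm_mul_star_le M
  have hPP : P * P = P := ha.mul_star_mul_mul_star le_rfl
  have hVP : ‖V * P‖ ≤ ‖V‖ := (norm_mul_le _ _).trans
    (mul_le_of_le_one_right (norm_nonneg _) hP1)
  have hWP : ‖W * P‖ ≤ ‖W‖ := (norm_mul_le _ _).trans
    (mul_le_of_le_one_right (norm_nonneg _) hP1)
  set y := star (V * P) * x.1 * (W * P) with hy
  have hdiff : y - c • P = star (V * P) * (x.1 - b) * (W * P) + ⟪eS A, (b - x.1) (eS B)⟫_ℂ • P := by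
    rw [mul_sub, sub_mul, hcomp, sub_apply, inner_sub_right, sub_smul]
    abel
  have hnorm : ‖y - c • P‖ < ‖c‖ := by
    refine lt_of_le_of_lt ?_ hxb
    have h1 : ‖star (V * P) * (x.1 - b) * (W * P)‖ ≤ ‖V‖ * ‖x.1 - b‖ * ‖W‖ := by
      refine (norm_mul_le _ _).trans (mul_le_mul ((norm_mul_le _ _).trans ?_) hWP
        (norm_nonneg _) (by positivity))
      rw [star_eq_adjoint, LinearIsometryEquiv.norm_map]
      gcongr
    have h2 : ‖⟪eS A, (b - x.1) (eS B)⟫_ℂ • P‖ ≤ ‖x.1 - b‖ := by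
      rw [norm_smul]
      refine (mul_le_of_le_one_right (norm_nonneg _) hP1).trans ?_
      refine (norm_inner_le_norm _ _).trans ?_
      rw [norm_eS, one_mul]
      refine (le_opNorm _ _).trans ?_
      rw [norm_eS, mul_one, norm_sub_rev]
    rw [hdiff]
    refine (norm_add_le _ _).trans ?_
    nlinarith
  set p : ↥(MonI a) := ⟨P, mul_star_mem_monI a M⟩ with hp
  set z : ↥(MonI a) := (c⁻¹ • star ⟨V * P, hVm M⟩) * x * ⟨W * P, hWm M⟩ with hz
  have hzI : z ∈ I := I.mul_mem_right _ _ (I.mul_mem_left _ _ hxI)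
  have hzy : z.1 = c⁻¹ • y := by
    rw [hz, hy, ← smul_mul_assoc, ← smul_mul_assoc]
    rfl
  have hd : ‖P - z.1‖ < 1 := by
    have : P - z.1 = -(c⁻¹ • (y - c • P)) := by
      rw [hzy, smul_sub, smul_smul, inv_mul_cancel₀ hc, one_smul, neg_sub]
    rw [this, norm_neg, norm_smul, norm_inv, inv_mul_lt_iff₀ (norm_pos_iff.2 hc), mul_one]
    exact hnorm
  have hpow : ∀ k : ℕ, ∃ w ∈ I, (w : ↥(MonI a)).1 = P - (P - z.1) ^ (k + 1) := by
    intro k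
    induction k with
    | zero => exact ⟨z, hzI, by simp⟩
    | succ k ih =>
      obtain ⟨w, hw, hwk⟩ := ih
      refine ⟨w * p + (p - w) * z,
        I.add_mem (I.mul_mem_right _ _ hw) (I.mul_mem_left _ _ hzI), ?_⟩
      change w.1 * P + (P - w.1) * z.1 = _
      rw [hwk, pow_succ _ (k + 1), sub_sub_cancel, sub_mul P, hPP, mul_sub]
      abel
  choose w hwI hw using hpow
  refine hI.mem_of_tendsto (f := w) (b := Filter.atTop) ?_ (Filter.Eventually.of_forall hwI)
  rw [tendsto_subtype_rng]
  simp only [hw]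
  have := (tendsto_pow_atTop_nhds_zero_of_norm_lt_one hd).comp (Filter.tendsto_add_atTop_nat 1)
  simpa using this.const_sub P

theorem mul_star_mem_of_mul_star_mem {a : ℤ → MF →L[ℂ] MF} (ha : IsMonotoneAnnihilation a)
    {I : TwoSidedIdeal ↥(MonI a)} {n : ℤ}
    (hn : (⟨a n * star (a n), mul_star_mem_monI a n⟩ : ↥(MonI a)) ∈ I) (m : ℤ) :
    (⟨a m * star (a m), mul_star_mem_monI a m⟩ : ↥(MonI a)) ∈ I := by
  rcases le_total n m with h | h
  · convert I.mul_mem_right _ ⟨a m * star (a m), mul_star_mem_monI a m⟩ hn using 1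
    exact Subtype.ext (ha.mul_star_mul_mul_star h).symm
  · induction m, h using Int.leInductionDown with
    | base => exact hn
    | pred k _ ih =>
      have h1 := I.mul_mem_right _ ⟨a k, mem_monI a k⟩ ih
      have h2 := I.mul_mem_left ⟨star (a k), star_mem (mem_monI a k)⟩ _ h1
      convert I.add_mem ih h2 using 1
      refine Subtype.ext ?_
      change a (k - 1) * star (a (k - 1)) =
        a k * star (a k) + star (a k) * (a k * star (a k) * a k)
      rw [ha.mul_star_mul le_rfl, ha.mul_star_sub_one]

/-- The non-unital monotone C*-algebra `𝔦` is simple: every norm-closed two-sided ideal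
is `{0}` or all of `𝔦`. -/
theorem stmt16 (a : ℤ → MF →L[ℂ] MF) (ha : IsMonotoneAnnihilation a)
    (I : TwoSidedIdeal ↥(MonI a)) (hI : IsClosed (I : Set ↥(MonI a))) :
    I = ⊥ ∨ I = ⊤ := by
  by_cases h : ∀ x ∈ I, x = 0
  · exact Or.inl (le_bot_iff.1 fun x hx => (TwoSidedIdeal.mem_bot _).2 (h x hx))
  push Not at h
  obtain ⟨x, hxI, hx⟩ := h
  obtain ⟨n, hn⟩ := exists_mul_star_mem ha hI hxI hx
  refine Or.inr (top_le_iff.1 fun y _ => ?_)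
  refine hI.closure_subset_iff.2 (Set.Subset.refl _) (Metric.mem_closure_iff.2 fun ε hε => ?_)
  obtain ⟨b, hb, hyb⟩ := Metric.mem_closure_iff.1 (show y.1 ∈ closure _ from y.2) ε hε
  have hbm : b ∈ MonI a := NonUnitalStarSubalgebra.le_topologicalClosure _ hb
  refine ⟨⟨b, hbm⟩, ?_, hyb⟩
  obtain ⟨m, hm⟩ := ha.exists_mul_star_mul_eq hb
  have := I.mul_mem_right _ ⟨b, hbm⟩ (mul_star_mem_of_mul_star_mem ha hn m)
  rwa [show (⟨a m * star (a m), mul_star_mem_monI a m⟩ : ↥(MonI a)) * ⟨b, hbm⟩ = ⟨b, hbm⟩ from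
    Subtype.ext hm] at this
end
end
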